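/- Let (X, μ, T) be a dynamical system with X 0-dimensional, and let a ≤ b be reals. If r_top(ρ_μ) ∩ [a,b] = ∅, then there is a non-empty clopen subset A ⊂ X such that ρ_μ(x,y) ∉ [a,b] for all (x,y) ∈ R_T ∩ (A×A), i.e. for every x ∈ A and n ∈ ℤ with Tⁿx ∈ A one has ρ_μ(x, Tⁿx) ∉ [a,b]. -/

import Mathlib

open MeasureTheory Topology

/-- `X` is 0-dimensional: it has a countable base of clopen sets. -/
def ZeroDimensional (X : Type*) [TopologicalSpace X] : Prop :=
  ∃ b : Set (Set X), b.Countable ∧ (∀ s ∈ b, IsClopen s) ∧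
    TopologicalSpace.IsTopologicalBasis b

/-- A dynamical system: a non-atomic Borel probability measure of full support on a
topological space together with an ergodic non-singular homeomorphism whose
Radon–Nikodym derivative `d(μ∘T)/dμ` has the continuous version `ω`. -/
structure DynSys (X : Type*) [TopologicalSpace X] [MeasurableSpace X] where
  μ : Measure X
  T : X ≃ₜ X
  ω : X → ℝ
  prob : IsProbabilityMeasure μ
  noAtoms : NoAtoms μ
  fullSupport : ∀ U : Set X, IsOpen U → U.Nonempty → 0 < μ U
  ergodic : ∀ A : Set X, MeasurableSet A → (⇑T) ⁻¹' A = A → μ A = 0 ∨ μ A = 1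
  ωCont : Continuous ω
  ωPos : ∀ x, 0 < ω x
  rnDeriv : Measure.map (⇑T.symm) μ = μ.withDensity (fun x => ENNReal.ofReal (ω x))

namespace DynSys

variable {X Y : Type*} [TopologicalSpace X] [MeasurableSpace X]
  [TopologicalSpace Y] [MeasurableSpace Y]

/-- The iterate `Tⁿ` for `n : ℤ`. -/
noncomputable def iter (D : DynSys X) (n : ℤ) (x : X) : X :=
  (D.T.toEquiv ^ n) x

/-- The Radon–Nikodym cocycle `ρ_μ(x, Tⁿx)`. -/
noncomputable def rho (D : DynSys X) (x : X) (n : ℤ) : ℝ :=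
  if 0 ≤ n then ∑ i ∈ Finset.range n.toNat, Real.log (D.ω (D.iter (i : ℤ) x))
  else - ∑ i ∈ Finset.range (-n).toNat, Real.log (D.ω (D.iter (i : ℤ) (D.iter n x)))

/-- An inessential reduction: a `T`-invariant dense `G_δ` subset of full measure. -/
def InessRed (D : DynSys X) (X' : Set X) : Prop :=
  (⇑D.T) ⁻¹' X' = X' ∧ Dense X' ∧ IsGδ X' ∧ D.μ X' = 1

/-- A set is virtually clopen if its intersection with some inessential reduction `X'`
is relatively clopen in `X'`. -/
def VirtClopen (D : DynSys X) (A : Set X) : Prop :=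
  ∃ X' : Set X, D.InessRed X' ∧ IsClopen (Subtype.val ⁻¹' A : Set X')

/-- The asymptotic range `r(ρ_μ)` of the Radon–Nikodym cocycle. -/
def asymRange (D : DynSys X) : Set ℝ :=
  {t | ∀ ε : ℝ, 0 < ε → ∀ A : Set X, MeasurableSet A → 0 < D.μ A →
    ∃ k : ℤ, k ≠ 0 ∧ ∃ B : Set X, MeasurableSet B ∧ B ⊆ A ∧ 0 < D.μ B ∧
      ∀ x ∈ B, |D.rho x k - t| < ε}

/-- The topological asymptotic range `r_top(ρ_μ)` of the Radon–Nikodym cocycle. -/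
def topAsymRange (D : DynSys X) : Set ℝ :=
  {t | ∀ ε : ℝ, 0 < ε → ∀ A : Set X, D.VirtClopen A → 0 < D.μ A →
    ∃ k : ℤ, k ≠ 0 ∧ ∃ B : Set X, B ⊆ A ∧ 0 < D.μ B ∧
      ∀ x ∈ B, |D.rho x k - t| < ε}

/-- Type `III`: there is no equivalent σ-finite `T`-invariant measure. -/
def TypeIII (D : DynSys X) : Prop :=
  ¬ ∃ ν : Measure X, SigmaFinite ν ∧ ν ≪ D.μ ∧ D.μ ≪ ν ∧ Measure.map (⇑D.T) ν = ν

/-- Almost continuous orbit equivalence of two dynamical systems. -/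
def ACOE (D : DynSys X) (E : DynSys Y) : Prop :=
  ∃ (X₀ : Set X) (Y₀ : Set Y) (φ : X → Y) (ψ : Y → X),
    D.InessRed X₀ ∧ E.InessRed Y₀ ∧
    Set.BijOn φ X₀ Y₀ ∧ ContinuousOn φ X₀ ∧ ContinuousOn ψ Y₀ ∧ Set.InvOn ψ φ X₀ Y₀ ∧
    (∀ x ∈ X₀, φ '' {z | ∃ k : ℤ, z = D.iter k x} = {w | ∃ k : ℤ, w = E.iter k (φ x)}) ∧
    (∃ f : Y → ℝ, ContinuousOn f Y₀ ∧ (∀ y ∈ Y₀, 0 < f y) ∧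
      ∀ A : Set Y, MeasurableSet A →
        D.μ (φ ⁻¹' A ∩ X₀) = ∫⁻ y in A, ENNReal.ofReal (f y) ∂E.μ) ∧
    (∃ n m : X → ℤ, ContinuousOn n X₀ ∧ ContinuousOn m X₀ ∧
      ∀ x ∈ X₀, φ (D.T x) = E.iter (n x) (φ x) ∧ E.T (φ x) = φ (D.iter (m x) x))

end DynSys

/-- An `r`-uniform subrelation of `R_T` on the clopen set `C`, with fundamental
(clopen) subset `B` and splitting homeomorphism `(i, b) ↦ h i b : I_r × B → C`,
each `h i` being given on `B` by `h i b = T^(a i b) b` with `a i` continuous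
(i.e. `h i` belongs to the topological full groupoid `[[T]]_top`);
`proj` and `idx` form the continuous inverse, `proj` being the associated projection. -/
structure UniformRel {X : Type*} [TopologicalSpace X] [MeasurableSpace X]
    (D : DynSys X) (r : ℕ) (C B : Set X) where
  rpos : 0 < r
  h : Fin r → X → X
  a : Fin r → X → ℤ
  clopenB : IsClopen B
  subB : B ⊆ C
  h_zero : ∀ b ∈ B, h ⟨0, rpos⟩ b = b
  h_eq : ∀ (i : Fin r), ∀ b ∈ B, h i b = D.iter (a i b) b
  a_cont : ∀ i : Fin r, ContinuousOn (a i) B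
  h_cont : ∀ i : Fin r, ContinuousOn (h i) B
  maps : ∀ i : Fin r, Set.MapsTo (h i) B C
  inj : ∀ (i j : Fin r), ∀ b ∈ B, ∀ b' ∈ B, h i b = h j b' → i = j ∧ b = b'
  proj : X → X
  idx : X → Fin r
  proj_cont : ContinuousOn proj C
  idx_cont : ContinuousOn idx C
  proj_mem : ∀ x ∈ C, proj x ∈ B
  h_proj : ∀ x ∈ C, h (idx x) (proj x) = x

namespace DynSys

section Cocycle

variable {X : Type*} [TopologicalSpace X] [MeasurableSpace X] (D : DynSys X)

@[simp]
theorem iter_zero (x : X) : D.iter 0 x = x := by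
  simp [iter]

theorem iter_add (m n : ℤ) (x : X) : D.iter (m + n) x = D.iter n (D.iter m x) := by
  rw [add_comm]
  simp [iter, zpow_add, Equiv.Perm.mul_apply]

theorem iter_one (x : X) : D.iter 1 x = D.T x := by
  simp [iter]

theorem iter_neg_one (x : X) : D.iter (-1) x = D.T.symm x := by
  have h : D.T (D.iter (-1) x) = x := by
    rw [← iter_one, ← iter_add]
    simp
  rw [← D.T.symm_apply_apply (D.iter (-1) x), h]

theorem iter_add_one (n : ℤ) (x : X) : D.iter (n + 1) x = D.T (D.iter n x) := by
  rw [iter_add, iter_one]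

theorem iter_sub_one (n : ℤ) (x : X) : D.iter (n - 1) x = D.T.symm (D.iter n x) := by
  rw [sub_eq_add_neg, iter_add, iter_neg_one]

theorem continuous_iter (n : ℤ) : Continuous (D.iter n) := by
  induction n using Int.induction_on with
  | zero => simpa [funext D.iter_zero] using continuous_id'
  | succ n ih =>
    rw [funext (D.iter_add_one n)]
    exact D.T.continuous.comp ih
  | pred n ih =>
    rw [funext (D.iter_sub_one (-n))]
    exact D.T.symm.continuous.comp ih

@[simp]
theorem rho_zero (x : X) : D.rho x 0 = 0 := by
  simp [rho]

theorem rho_add_one (x : X) (n : ℤ) :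
    D.rho x (n + 1) = D.rho x n + Real.log (D.ω (D.iter n x)) := by
  rcases le_or_gt 0 n with hn | hn
  · lift n to ℕ using hn
    have h : ((n : ℤ) + 1).toNat = n + 1 := by omega
    simp [rho, h, Finset.sum_range_succ, show (0 : ℤ) ≤ n + 1 by omega]
  · obtain ⟨m, rfl⟩ : ∃ m : ℕ, n = -(m + 1 : ℤ) := ⟨(-n - 1).toNat, by omega⟩
    have hsum : D.rho x (-(m + 1 : ℤ) + 1)
        = -∑ i ∈ Finset.range m, Real.log (D.ω (D.iter ((i + 1 : ℕ) - (m + 1 : ℤ)) x)) := by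
      rcases Nat.eq_zero_or_pos m with rfl | hm
      · simp
      · rw [rho, if_neg (by omega), show (-(-(m + 1 : ℤ) + 1)).toNat = m by omega]
        congr 1
        refine Finset.sum_congr rfl fun i _ => ?_
        rw [← iter_add]
        congr 4
        push_cast
        ring
    rw [hsum, rho, if_neg (by omega), show (-(-(m + 1 : ℤ))).toNat = m + 1 by omega,
      Finset.sum_range_succ']
    simp only [← iter_add, neg_add_eq_sub, Nat.cast_zero, zero_sub]
    ring

theorem rho_add (x : X) (m n : ℤ) :
    D.rho x (m + n) = D.rho x m + D.rho (D.iter m x) n := by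
  induction n using Int.induction_on with
  | zero => simp
  | succ n ih =>
    rw [← add_assoc, rho_add_one, rho_add_one, ih, iter_add]
    ring
  | pred n ih =>
    have h₁ := D.rho_add_one x (m + (-n - 1))
    have h₂ := D.rho_add_one (D.iter m x) (-n - 1)
    rw [show m + (-(n : ℤ) - 1) + 1 = m + -n by ring, ih, iter_add] at h₁
    rw [show -(n : ℤ) - 1 + 1 = -n by ring] at h₂
    linarith

theorem continuous_rho (n : ℤ) : Continuous fun x => D.rho x n := by
  have hlog (n : ℤ) : Continuous fun x => Real.log (D.ω (D.iter n x)) :=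
    (D.ωCont.comp (D.continuous_iter n)).log fun x => (D.ωPos _).ne'
  induction n using Int.induction_on with
  | zero => simpa using continuous_const
  | succ n ih =>
    simp only [rho_add_one]
    exact ih.add (hlog n)
  | pred n ih =>
    have h (x : X) : D.rho x (-n - 1) = D.rho x (-n) - Real.log (D.ω (D.iter (-n - 1) x)) := by
      have := D.rho_add_one x (-n - 1)
      rw [show -(n : ℤ) - 1 + 1 = -n by ring] at this
      linarith
    simp only [h]
    exact ih.sub (hlog _)

/-- If the return values of the cocycle to `A` stay `ε`-separated from `0`, its exponentials are
dominated by a geometric series along the non-positive returns of an orbit. -/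
theorem tsum_exp_rho_le {ε : ℝ} (hε : 0 < ε) {A : Set X}
    (hA : ∀ x ∈ A, ∀ n : ℤ, n ≠ 0 → D.iter n x ∈ A → ε ≤ |D.rho x n|) (y : X) (S : Set ℤ)
    (hS : ∀ n ∈ S, D.iter n y ∈ A ∧ D.rho y n ≤ 0) :
    ∑' n : S, ENNReal.ofReal (Real.exp (D.rho y n))
      ≤ ∑' m : ℕ, ENNReal.ofReal (Real.exp (m * -ε)) := by
  have hinj : Function.Injective fun n : S => ⌊-D.rho y n / ε⌋₊ := by
    rintro ⟨m, hm⟩ ⟨n, hn⟩ hmn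
    by_contra hne
    have hne' : n - m ≠ 0 := fun h => hne (Subtype.ext (by simp only; omega))
    have h₁ := hA _ (hS m hm).1 (n - m) hne' (by
      rw [← iter_add, add_sub_cancel]
      exact (hS n hn).1)
    have h₂ := D.rho_add y m (n - m)
    rw [add_sub_cancel] at h₂
    have h₃ : |(-D.rho y m / ε) - (-D.rho y n / ε)| < 1 := by
      have hm0 : 0 ≤ -D.rho y m / ε := div_nonneg (neg_nonneg.2 (hS m hm).2) hε.le
      have hn0 : 0 ≤ -D.rho y n / ε := div_nonneg (neg_nonneg.2 (hS n hn).2) hε.le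
      have e₁ := Nat.floor_le hm0
      have e₂ := Nat.floor_le hn0
      have e₃ := Nat.lt_floor_add_one (-D.rho y m / ε)
      have e₄ := Nat.lt_floor_add_one (-D.rho y n / ε)
      simp only at hmn
      rw [hmn] at e₁ e₃
      rw [abs_lt]
      constructor <;> linarith
    rw [← sub_div, abs_div, abs_of_pos hε, div_lt_one hε, h₂] at h₃
    have h₄ : -D.rho y m - -(D.rho y m + D.rho (D.iter m y) (n - m))
        = D.rho (D.iter m y) (n - m) := by ring
    rw [h₄] at h₃
    exact h₃.not_ge h₁
  refine le_trans (ENNReal.tsum_le_tsum fun n => ?_)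
    (ENNReal.tsum_comp_le_tsum_of_injective hinj
      fun m : ℕ => ENNReal.ofReal (Real.exp (m * -ε)))
  refine ENNReal.ofReal_le_ofReal (Real.exp_le_exp.2 ?_)
  have := Nat.floor_le (div_nonneg (neg_nonneg.2 (hS n n.2).2) hε.le)
  rw [le_div_iff₀ hε] at this
  linarith

end Cocycle

section Measure

variable {X : Type*} [TopologicalSpace X] [MeasurableSpace X] [BorelSpace X] (D : DynSys X)

theorem lintegral_eq_lintegral_comp_T {g : X → ENNReal} (hg : Measurable g) :
    ∫⁻ x, g x ∂D.μ = ∫⁻ x, g (D.T x) * ENNReal.ofReal (D.ω x) ∂D.μ := by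
  have hgT : Measurable fun x => g (D.T x) := hg.comp D.T.continuous.measurable
  have h : ∫⁻ x, g (D.T x) ∂(Measure.map (⇑D.T.symm) D.μ) = ∫⁻ x, g x ∂D.μ := by
    rw [lintegral_map hgT D.T.symm.continuous.measurable]
    simp
  rw [← h, D.rnDeriv,
    lintegral_withDensity_eq_lintegral_mul _ D.ωCont.measurable.ennreal_ofReal hgT]
  simp only [Pi.mul_apply, mul_comm]

theorem lintegral_eq_lintegral_comp_iter (n : ℤ) {g : X → ENNReal} (hg : Measurable g) :
    ∫⁻ x, g x ∂D.μ
      = ∫⁻ x, g (D.iter n x) * ENNReal.ofReal (Real.exp (D.rho x n)) ∂D.μ := by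
  induction n using Int.induction_on generalizing g with
  | zero => simp
  | succ n ih =>
    rw [D.lintegral_eq_lintegral_comp_T hg,
      ih (g := fun x => g (D.T x) * ENNReal.ofReal (D.ω x))
        ((hg.comp D.T.continuous.measurable).mul D.ωCont.measurable.ennreal_ofReal)]
    refine lintegral_congr fun x => ?_
    rw [rho_add_one, iter_add_one, Real.exp_add, Real.exp_log (D.ωPos _), mul_assoc,
      ← ENNReal.ofReal_mul (D.ωPos _).le, mul_comm (D.ω _)]
  | pred n ih =>
    have hω : Measurable fun x => ENNReal.ofReal (D.ω (D.T.symm x))⁻¹ :=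
      (D.ωCont.comp D.T.symm.continuous).measurable.inv.ennreal_ofReal
    have hh : Measurable fun x => g (D.T.symm x) * ENNReal.ofReal (D.ω (D.T.symm x))⁻¹ :=
      (hg.comp D.T.symm.continuous.measurable).mul hω
    have h₁ := D.lintegral_eq_lintegral_comp_T hh
    have h₂ := ih hh
    rw [h₁] at h₂
    convert h₂ using 1
    · refine lintegral_congr fun x => ?_
      rw [D.T.symm_apply_apply, mul_assoc, ← ENNReal.ofReal_mul (inv_pos.2 (D.ωPos x)).le,
        inv_mul_cancel₀ (D.ωPos x).ne', ENNReal.ofReal_one, mul_one]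
    · refine lintegral_congr fun x => ?_
      have h := D.rho_add_one x (-n - 1)
      rw [show -(n : ℤ) - 1 + 1 = -n by ring] at h
      rw [← iter_sub_one, h, Real.exp_add, Real.exp_log (D.ωPos _), mul_assoc,
        ← ENNReal.ofReal_mul (inv_pos.2 (D.ωPos _)).le, mul_comm (Real.exp _),
        inv_mul_cancel_left₀ (D.ωPos _).ne']

theorem measure_iUnion_preimage_iter {V : Set X} (hV : MeasurableSet V) (hpos : 0 < D.μ V) :
    D.μ (⋃ n : ℤ, D.iter n ⁻¹' V) = 1 := by
  refine (D.ergodic _ (.iUnion fun n => (D.continuous_iter n).measurable hV) ?_).resolve_left ?_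
  · ext x
    simp only [Set.mem_preimage, Set.mem_iUnion, ← iter_one, ← iter_add]
    exact ((Equiv.addLeft (1 : ℤ)).surjective.exists (p := fun n => D.iter n x ∈ V)).symm
  · refine (hpos.trans_le (measure_mono fun x hx => ?_)).ne'
    exact Set.mem_iUnion.2 ⟨0, by simpa using hx⟩

theorem exists_iter_mem {U V : Set X} (hU : IsOpen U) (hU' : U.Nonempty)
    (hV : IsOpen V) (hV' : V.Nonempty) : ∃ x ∈ U, ∃ n : ℤ, D.iter n x ∈ V := by
  have := D.prob
  by_contra! h
  have h₁ := D.measure_iUnion_preimage_iter hV.measurableSet (D.fullSupport V hV hV')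
  have h₂ : Disjoint U (⋃ n : ℤ, D.iter n ⁻¹' V) := by
    refine Set.disjoint_left.2 fun x hx hx' => ?_
    obtain ⟨n, hn⟩ := Set.mem_iUnion.1 hx'
    exact h x hx n hn
  have h₃ := measure_union (μ := D.μ) h₂
    (.iUnion fun n => (D.continuous_iter n).measurable hV.measurableSet)
  have h₄ : D.μ (U ∪ ⋃ n : ℤ, D.iter n ⁻¹' V) ≤ 1 := prob_le_one
  rw [h₃, h₁] at h₄
  have h₆ : D.μ U + 1 ≤ 0 + 1 := by simpa using h₄
  exact (D.fullSupport U hU hU').not_ge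
    ((ENNReal.add_le_add_iff_right ENNReal.one_ne_top).1 h₆)

end Measure

end DynSys

/-- A non-null set of a non-atomic measure splits into two non-null parts. -/
theorem exists_isOpen_measure_inter_pos_diff_pos {X : Type*} [TopologicalSpace X]
    [SecondCountableTopology X] [T0Space X] [MeasurableSpace X] (μ : Measure X) [NullSingletonClass μ]
    {W : Set X} (hW : 0 < μ W) :
    ∃ s : Set X, IsOpen s ∧ 0 < μ (W ∩ s) ∧ 0 < μ (W \ s) := by
  by_contra! h
  obtain ⟨b, hbc, -, hb⟩ := TopologicalSpace.exists_countable_basis X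
  have hnull : μ (⋃ s ∈ b, if μ (W ∩ s) = 0 then W ∩ s else W \ s) = 0 := by
    refine (measure_biUnion_null_iff hbc).2 fun s hs => ?_
    split_ifs with h0
    · exact h0
    · exact nonpos_iff_eq_zero.1 (h s (hb.isOpen hs) (pos_iff_ne_zero.2 h0))
  have hsub : (W \ ⋃ s ∈ b, if μ (W ∩ s) = 0 then W ∩ s else W \ s).Subsingleton := by
    intro x hx y hy
    refine hb.eq_iff.2 fun s hs => ?_
    have hx' : x ∉ (if μ (W ∩ s) = 0 then W ∩ s else W \ s) :=
      fun hc => hx.2 (Set.mem_biUnion hs hc)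
    have hy' : y ∉ (if μ (W ∩ s) = 0 then W ∩ s else W \ s) :=
      fun hc => hy.2 (Set.mem_biUnion hs hc)
    split_ifs at hx' hy' with h0
    · exact iff_of_false (fun h => hx' ⟨hx.1, h⟩) fun h => hy' ⟨hy.1, h⟩
    · exact iff_of_true (by_contra fun h => hx' ⟨hx.1, h⟩) (by_contra fun h => hy' ⟨hy.1, h⟩)
  have := measure_sdiff_null (s := W) hnull
  rw [hsub.measure_zero] at this
  exact hW.ne this

namespace DynSys

variable {X : Type*} [TopologicalSpace X] [MeasurableSpace X] [BorelSpace X] (D : DynSys X)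

/-- The transformation is conservative: a wandering set is null. -/
theorem measure_eq_zero_of_wandering [SecondCountableTopology X] [T0Space X] {W : Set X}
    (hW : MeasurableSet W) (hwand : ∀ x ∈ W, ∀ n : ℤ, n ≠ 0 → D.iter n x ∉ W) : D.μ W = 0 := by
  have := D.prob
  have : NullSingletonClass D.μ := D.noAtoms
  by_contra h0
  obtain ⟨s, hs, h₁, h₂⟩ := exists_isOpen_measure_inter_pos_diff_pos D.μ (pos_iff_ne_zero.2 h0)
  have hm : MeasurableSet (⋃ n : ℤ, D.iter n ⁻¹' (W ∩ s)) :=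
    .iUnion fun n => (D.continuous_iter n).measurable (hW.inter hs.measurableSet)
  have h₃ := D.measure_iUnion_preimage_iter (hW.inter hs.measurableSet) h₁
  refine h₂.ne' (measure_mono_null ?_ ((prob_compl_eq_zero_iff hm).2 h₃))
  intro x hx hx'
  obtain ⟨n, hn⟩ := Set.mem_iUnion.1 hx'
  rcases eq_or_ne n 0 with rfl | hn0
  · exact hx.2 (by simpa using hn.2)
  · exact hwand x hx.1 n hn0 hn.1

theorem measurable_indicator_comp_iter_mul {A : Set X} (hA : MeasurableSet A) (n : ℤ) :
    Measurable fun x => A.indicator (1 : X → ENNReal) (D.iter n x) *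
      ENNReal.ofReal (Real.exp (D.rho x n)) :=
  ((measurable_one.indicator hA).comp (D.continuous_iter n).measurable).mul
    (Real.measurable_exp.comp (D.continuous_rho n).measurable).ennreal_ofReal

/-- The Radon–Nikodym cocycle is recurrent: it cannot stay away from `0` on all returns to a
non-null set. -/
theorem measure_eq_zero_of_le_abs_rho [SecondCountableTopology X] [T0Space X] {ε : ℝ}
    (hε : 0 < ε) {A : Set X} (hAm : MeasurableSet A)
    (hA : ∀ x ∈ A, ∀ n : ℤ, n ≠ 0 → D.iter n x ∈ A → ε ≤ |D.rho x n|) : D.μ A = 0 := by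
  have := D.prob
  set E : ℤ → Set X := fun k => {x | x ∈ A ∧ D.iter k x ∈ A ∧ 0 ≤ D.rho x k} with hE
  have hEm (k : ℤ) : MeasurableSet (E k) :=
    hAm.inter (((D.continuous_iter k).measurable hAm).inter
      (measurableSet_le measurable_const (D.continuous_rho k).measurable))
  have hterm (k : ℤ) : D.μ (E k) = ∫⁻ y, (E k).indicator 1 (D.iter (-k) y) *
      ENNReal.ofReal (Real.exp (D.rho y (-k))) ∂D.μ := by
    rw [← D.lintegral_eq_lintegral_comp_iter (-k) (measurable_one.indicator (hEm k)),
      lintegral_indicator_one (hEm k)]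
  have hsum : ∑' k, D.μ (E k) ≠ ⊤ := by
    simp only [hterm]
    rw [← lintegral_tsum fun k =>
      (D.measurable_indicator_comp_iter_mul (hEm k) (-k)).aemeasurable]
    have hC : ∑' m : ℕ, ENNReal.ofReal (Real.exp (m * -ε)) ≠ ⊤ :=
      (Real.summable_exp_nat_mul_iff.2 (neg_lt_zero.2 hε)).tsum_ofReal_ne_top
    refine ne_top_of_le_ne_top hC (le_trans (lintegral_mono fun y => ?_)
      (by simp : ∫⁻ _, ∑' m : ℕ, ENNReal.ofReal (Real.exp (m * -ε)) ∂D.μ ≤ _))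
    refine le_trans ?_ (D.tsum_exp_rho_le hε hA y {n | D.iter n y ∈ E (-n)} ?_)
    · rw [tsum_subtype {n | D.iter n y ∈ E (-n)}
        fun n => ENNReal.ofReal (Real.exp (D.rho y n)), ← (Equiv.neg ℤ).tsum_eq]
      refine ENNReal.tsum_le_tsum fun k => ?_
      by_cases hk : D.iter k y ∈ E (-k)
      · simp [hk]
      · simp [hk]
    · intro n hn
      refine ⟨hn.1, ?_⟩
      have h₁ := D.rho_add y n (-n)
      have h₂ : 0 ≤ D.rho (D.iter n y) (-n) := hn.2.2
      rw [add_neg_cancel, rho_zero] at h₁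
      linarith
  set W : Set X := {x | x ∈ A ∧ ∀ n : ℤ, n ≠ 0 → x ∉ E n} with hW
  have hWm : MeasurableSet W := by
    have : W = A ∩ ⋂ n : ℤ, ⋂ _ : n ≠ 0, (E n)ᶜ := by
      ext x
      simp [hW]
    rw [this]
    exact hAm.inter (.iInter fun n => .iInter fun _ => (hEm n).compl)
  have hWnull : D.μ W = 0 := by
    refine D.measure_eq_zero_of_wandering hWm fun x hx n hn hx' => ?_
    have h₁ := D.rho_add x n (-n)
    rw [add_neg_cancel, rho_zero] at h₁
    rcases le_total 0 (D.rho x n) with h | h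
    · exact hx.2 n hn ⟨hx.1, hx'.1, h⟩
    · refine hx'.2 (-n) (neg_ne_zero.2 hn) ⟨hx'.1, ?_, by linarith⟩
      rw [← iter_add, add_neg_cancel, iter_zero]
      exact hx.1
  have hUnull : D.μ (⋃ n : ℤ, D.iter n ⁻¹' W) = 0 := by
    refine measure_iUnion_null fun n => ?_
    have hm := (D.continuous_iter n).measurable hWm
    have h := D.lintegral_eq_lintegral_comp_iter n (measurable_one.indicator hWm)
    rw [lintegral_indicator_one hWm, hWnull, eq_comm, 
      lintegral_eq_zero_iff (D.measurable_indicator_comp_iter_mul hWm n)] at h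
    refine measure_mono_null (fun x hx => ?_) (ae_iff.1 h)
    have hx' : D.iter n x ∈ W := hx
    simp [hx', Real.exp_pos]
  have hfin := ae_finite_setOfPred_mem hsum
  refine measure_mono_null (fun x hx => ?_) (measure_union_null hUnull (ae_iff.1 hfin))
  by_contra hx'
  rw [Set.mem_union, not_or] at hx'
  have hF : {k | x ∈ E k}.Finite := not_not.1 hx'.2
  obtain ⟨k, hk, hmax⟩ := hF.exists_maximalFor (fun k => D.rho x k) _ ⟨0, by simp [hE, hx]⟩
  refine hx'.1 (Set.mem_iUnion.2 ⟨k, hk.2.1, fun n hn hn' => ?_⟩)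
  have h₁ := D.rho_add x k n
  have h₂ : 0 ≤ D.rho x k := hk.2.2
  have h₃ : 0 ≤ D.rho (D.iter k x) n := hn'.2.2
  have h₄ := hA _ hk.2.1 n hn hn'.2.1
  rw [abs_of_nonneg h₃] at h₄
  have h₅ := hmax (j := k + n) ⟨hx, by rw [iter_add]; exact hn'.2.1, by linarith⟩
    (by simp only; linarith)
  simp only at h₅
  linarith

theorem exists_open_le_abs_rho_sub {t : ℝ} (ht : t ∉ D.topAsymRange) :
    ∃ ε : ℝ, 0 < ε ∧ ∃ U : Set X, IsOpen U ∧ U.Nonempty ∧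
      ∀ x ∈ U, ∀ n : ℤ, n ≠ 0 → ε ≤ |D.rho x n - t| := by
  have := D.prob
  simp only [topAsymRange, Set.mem_ofPred_eq, not_forall] at ht
  obtain ⟨ε, hε, A, ⟨X', ⟨-, -, hGδ, hX'⟩, hclopen⟩, hApos, hA⟩ := ht
  push Not at hA
  obtain ⟨U, hU, hUA⟩ := isOpen_induced_iff.1 hclopen.isOpen
  have hmem {x : X} (hx : x ∈ X') : x ∈ U ↔ x ∈ A :=
    Set.ext_iff.1 hUA ⟨x, hx⟩
  have hnull : D.μ X'ᶜ = 0 := (prob_compl_eq_zero_iff hGδ.measurableSet).2 hX'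
  refine ⟨ε, hε, U, hU, ?_, fun x hx n hn => ?_⟩
  · by_contra hempty
    rw [Set.not_nonempty_iff_eq_empty] at hempty
    refine hApos.ne' (measure_mono_null (t := X'ᶜ) (fun x hx hx' => ?_) hnull)
    have := (hmem hx').2 hx
    simp [hempty] at this
  · by_contra! hlt
    have hopen : IsOpen (U ∩ {y | |D.rho y n - t| < ε}) :=
      hU.inter (isOpen_lt ((D.continuous_rho n).sub continuous_const).abs continuous_const)
    have hB : D.μ (A ∩ {y | |D.rho y n - t| < ε}) = 0 := by
      by_contra hne
      obtain ⟨y, hy, hy'⟩ := hA n hn _ Set.inter_subset_left (pos_iff_ne_zero.2 hne)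
      exact hy'.not_gt hy.2
    refine (D.fullSupport _ hopen ⟨x, hx, hlt⟩).ne'
      (measure_mono_null (fun y hy => ?_) (measure_union_null hB hnull))
    by_cases hy' : y ∈ X'
    · exact Or.inl ⟨(hmem hy').1 hy.1, hy.2⟩
    · exact Or.inr hy'

theorem zero_mem_topAsymRange [SecondCountableTopology X] [T0Space X] :
    (0 : ℝ) ∈ D.topAsymRange := by
  by_contra h
  obtain ⟨ε, hε, U, hU, hU', hUε⟩ := D.exists_open_le_abs_rho_sub h
  refine (D.fullSupport U hU hU').ne' (D.measure_eq_zero_of_le_abs_rho hε hU.measurableSet ?_)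
  intro x hx n hn _
  simpa using hUε x hx n hn

/-- Transporting an open set of points along the orbits into `U` preserves, up to a factor `2`,
the distance of the return values of the cocycle from `t`. -/
theorem exists_open_subset_half_le_abs_rho_sub {t ε : ℝ} (hε : 0 < ε) {U V : Set X}
    (hU : IsOpen U) (hU' : U.Nonempty)
    (hUε : ∀ x ∈ U, ∀ n : ℤ, n ≠ 0 → ε ≤ |D.rho x n - t|)
    (hV : IsOpen V) (hV' : V.Nonempty) :
    ∃ V' ⊆ V, IsOpen V' ∧ V'.Nonempty ∧
      ∀ x ∈ V', ∀ n : ℤ, n ≠ 0 → D.iter n x ∈ V' → ε / 2 ≤ |D.rho x n - t| := by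
  obtain ⟨x₀, hx₀, j, hj⟩ := D.exists_iter_mem hV hV' hU hU'
  refine ⟨V ∩ (D.iter j ⁻¹' U ∩ {y | |D.rho y j - D.rho x₀ j| < ε / 4}),
    Set.inter_subset_left, ?_, ⟨x₀, hx₀, hj, by simpa using hε⟩, ?_⟩
  · exact hV.inter ((hU.preimage (D.continuous_iter j)).inter
      (isOpen_lt ((D.continuous_rho j).sub continuous_const).abs continuous_const))
  · rintro x ⟨-, hxU, hxj⟩ n hn ⟨-, -, hyj⟩
    have h₁ := hUε _ hxU n hn
    have h₂ := D.rho_add x n j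
    have h₃ := D.rho_add x j n
    rw [add_comm j n] at h₃
    rw [Set.mem_ofPred_eq, abs_lt] at hxj hyj
    by_contra! hlt
    rw [abs_lt] at hlt
    refine h₁.not_gt (abs_lt.2 ⟨?_, ?_⟩) <;> linarith [hxj.1, hxj.2, hyj.1, hyj.2, hlt.1, hlt.2]

theorem exists_open_forall_half_le_abs_rho_sub (ε : ℝ → ℝ) (F : Finset ℝ)
    (hF : ∀ t ∈ F, 0 < ε t ∧ ∃ U : Set X, IsOpen U ∧ U.Nonempty ∧
      ∀ x ∈ U, ∀ n : ℤ, n ≠ 0 → ε t ≤ |D.rho x n - t|) :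
    ∃ V : Set X, IsOpen V ∧ V.Nonempty ∧ ∀ t ∈ F, ∀ x ∈ V, ∀ n : ℤ, n ≠ 0 →
      D.iter n x ∈ V → ε t / 2 ≤ |D.rho x n - t| := by
  classical
  have := D.prob
  induction F using Finset.induction_on with
  | empty => exact ⟨Set.univ, isOpen_univ, nonempty_of_isProbabilityMeasure D.μ |>.elim
      fun x => ⟨x, trivial⟩, by simp⟩
  | insert t F _ ih =>
    obtain ⟨V, hV, hV', hVF⟩ := ih fun s hs => hF s (Finset.mem_insert_of_mem hs)
    obtain ⟨hε, U, hU, hU', hUε⟩ := hF t (Finset.mem_insert_self t F)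
    obtain ⟨V', hsub, hVo, hVn, hVε⟩ :=
      D.exists_open_subset_half_le_abs_rho_sub hε hU hU' hUε hV hV'
    refine ⟨V', hVo, hVn, fun s hs x hx n hn hx' => ?_⟩
    rcases Finset.mem_insert.1 hs with rfl | hs
    · exact hVε x hx n hn hx'
    · exact hVF s hs x (hsub hx) n hn (hsub hx')

end DynSys

/-- **Lemma 1.7.** If `r_top(ρ_μ) ∩ [a,b] = ∅` then there is a non-empty clopen set `A`
such that `ρ_μ(x,y) ∉ [a,b]` for all `(x,y) ∈ R_T ∩ (A × A)`. -/
theorem exists_clopen_avoiding_interval {X : Type*}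
    [TopologicalSpace X] [PolishSpace X] [MeasurableSpace X] [BorelSpace X]
    (D : DynSys X) (hzd : ZeroDimensional X)
    (a b : ℝ) (hab : a ≤ b)
    (h : D.topAsymRange ∩ Set.Icc a b = ∅) :
    ∃ A : Set X, IsClopen A ∧ A.Nonempty ∧
      ∀ x ∈ A, ∀ n : ℤ, D.iter n x ∈ A → D.rho x n ∉ Set.Icc a b := by
  have hnot (t : ℝ) (ht : t ∈ Set.Icc a b) : t ∉ D.topAsymRange := fun h' =>
    Set.notMem_empty t (h ▸ ⟨h', ht⟩)
  have hloc (t : ℝ) : ∃ ε : ℝ, t ∈ Set.Icc a b → 0 < ε ∧ ∃ U : Set X, IsOpen U ∧ U.Nonempty ∧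
      ∀ x ∈ U, ∀ n : ℤ, n ≠ 0 → ε ≤ |D.rho x n - t| := by
    by_cases ht : t ∈ Set.Icc a b
    · obtain ⟨ε, hε⟩ := D.exists_open_le_abs_rho_sub (hnot t ht)
      exact ⟨ε, fun _ => hε⟩
    · exact ⟨0, fun ht' => absurd ht' ht⟩
  choose ε hε using hloc
  obtain ⟨F, hFsub, hFcover⟩ := (isCompact_Icc (a := a) (b := b)).elim_nhds_subcover
    (fun t => Metric.ball t (ε t / 2)) fun t ht => Metric.ball_mem_nhds t (half_pos (hε t ht).1)
  obtain ⟨V, hV, ⟨x₀, hx₀⟩, hVF⟩ :=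
    D.exists_open_forall_half_le_abs_rho_sub ε F fun t ht => hε t (hFsub t ht)
  obtain ⟨B, -, hBclopen, hB⟩ := hzd
  obtain ⟨A, hAB, hxA, hAV⟩ := hB.exists_subset_of_mem_open hx₀ hV
  refine ⟨A, hBclopen A hAB, ⟨x₀, hxA⟩, fun x hx n hn hmem => ?_⟩
  rcases eq_or_ne n 0 with rfl | hn0
  · rw [D.rho_zero] at hmem
    exact hnot 0 hmem D.zero_mem_topAsymRange
  · obtain ⟨t, htF, ht⟩ := Set.mem_iUnion₂.1 (hFcover hmem)
    rw [Metric.mem_ball, Real.dist_eq] at ht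
    exact ht.not_ge (hVF t htF x (hAV hx) n hn0 (hAV hn))
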